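/- arXiv:2105.09302 — 2 statements merged into one kernel-verified Lean document; each statement's English description precedes it below -/
import Mathlib

section
/- Let φ_o : ℝ³ → ℝ³ be differentiable at a point x, let φ_m, v : ℝ³ → ℝ³ be differentiable at φ_o(x), and let f_o(x) ∈ ℝ and g_o(x) ∈ ℝ³ be given. Set P(x) = det∇(φ_m ∘ φ_o)(x) − f_o(x) and Q(x) = ∇×(φ_m ∘ φ_o)(x) − g_o(x). Then the function t ↦ ½(det∇((φ_m + t·v) ∘ φ_o)(x) − f_o(x))² + ½‖∇×((φ_m + t·v) ∘ φ_o)(x) − g_o(x)‖² is differentiable at t = 0 with derivative P(x) · trace(adjugate(∇φ_m(φ_o(x))) · ∇v(φ_o(x))) · det∇φ_o(x) + Q(x)·(∇×(v ∘ φ_o))(x). -/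
noncomputable section

open RealInnerProductSpace

abbrev E3 := EuclideanSpace ℝ (Fin 3)

/-- `i`-th partial derivative of a scalar function on ℝ³. -/
def pd (i : Fin 3) (f : E3 → ℝ) (x : E3) : ℝ :=
  fderiv ℝ f x (EuclideanSpace.single i 1)

/-- Curl of a vector field on ℝ³. -/
def curlE (F : E3 → E3) (x : E3) : E3 :=
  (WithLp.equiv 2 (Fin 3 → ℝ)).symm
    ![pd 1 (fun y => F y 2) x - pd 2 (fun y => F y 1) x,
      pd 2 (fun y => F y 0) x - pd 0 (fun y => F y 2) x,
      pd 0 (fun y => F y 1) x - pd 1 (fun y => F y 0) x]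

/-- The Jacobian matrix of a map `ℝ³ → ℝ³` at a point. -/
def jacobianMatrix (φ : E3 → E3) (x : E3) : Matrix (Fin 3) (Fin 3) ℝ :=
  Matrix.of fun i j => fderiv ℝ φ x (EuclideanSpace.single j 1) i

open Matrix in
theorem Matrix.det_add_smul_fin_three {R : Type*} [CommRing R] (A B : Matrix (Fin 3) (Fin 3) R)
    (t : R) :
    (A + t • B).det =
      A.det + t * (A.adjugate * B).trace + t ^ 2 * (A * B.adjugate).trace + t ^ 3 * B.det := by
  simp only [det_fin_three, adjugate_fin_three, trace_fin_three, mul_apply, Fin.sum_univ_three,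
    add_apply, smul_apply, smul_eq_mul, of_apply, cons_val]
  ring

/-- Jacobi's formula along an affine line of `3 × 3` matrices. -/
theorem Matrix.hasDerivAt_det_add_smul_fin_three (A B : Matrix (Fin 3) (Fin 3) ℝ) :
    HasDerivAt (fun t : ℝ => (A + t • B).det) (A.adjugate * B).trace 0 := by
  simp only [Matrix.det_add_smul_fin_three]
  have h := hasDerivAt_id (0 : ℝ)
  exact ((((h.mul_const (A.adjugate * B).trace).const_add A.det).add
    ((h.pow 2).mul_const (A * B.adjugate).trace)).add
    ((h.pow 3).mul_const B.det)).congr_deriv (by simp)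

theorem jacobianMatrix_comp {f g : E3 → E3} {x : E3} (hf : DifferentiableAt ℝ f (g x))
    (hg : DifferentiableAt ℝ g x) :
    jacobianMatrix (f ∘ g) x = jacobianMatrix f (g x) * jacobianMatrix g x := by
  ext i j
  have expand (w : E3) : w = ∑ k, w k • EuclideanSpace.single k (1 : ℝ) := by
    ext l
    simp [Pi.single_apply]
  simp only [jacobianMatrix, Matrix.mul_apply, Matrix.of_apply, fderiv_comp x hf hg,
    ContinuousLinearMap.comp_apply]
  conv_lhs => rw [expand (fderiv ℝ g x (EuclideanSpace.single j 1))]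
  simp [mul_comm]

theorem jacobianMatrix_add_smul {f g : E3 → E3} {x : E3} (hf : DifferentiableAt ℝ f x)
    (hg : DifferentiableAt ℝ g x) (t : ℝ) :
    jacobianMatrix (fun y => f y + t • g y) x = jacobianMatrix f x + t • jacobianMatrix g x := by
  have h : fderiv ℝ (fun y => f y + t • g y) x = fderiv ℝ f x + t • fderiv ℝ g x :=
    (hf.hasFDerivAt.add (hg.hasFDerivAt.const_smul t)).fderiv
  ext i j
  simp [jacobianMatrix, h]

theorem pd_apply_eq_jacobianMatrix {f : E3 → E3} {x : E3} (hf : DifferentiableAt ℝ f x)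
    (i k : Fin 3) : pd i (fun y => f y k) x = jacobianMatrix f x k i := by
  have h := ((EuclideanSpace.proj k : E3 →L[ℝ] ℝ).hasFDerivAt.comp x hf.hasFDerivAt).fderiv
  exact congrArg (fun L : E3 →L[ℝ] ℝ => L (EuclideanSpace.single i 1)) h

theorem curlE_add_smul {f g : E3 → E3} {x : E3} (hf : DifferentiableAt ℝ f x)
    (hg : DifferentiableAt ℝ g x) (t : ℝ) :
    curlE (fun y => f y + t • g y) x = curlE f x + t • curlE g x := by
  have hfg : DifferentiableAt ℝ (fun y => f y + t • g y) x := hf.add (hg.const_smul t)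
  simp only [curlE, pd_apply_eq_jacobianMatrix hfg, pd_apply_eq_jacobianMatrix hf,
    pd_apply_eq_jacobianMatrix hg, jacobianMatrix_add_smul hf hg]
  ext i
  fin_cases i <;> simp <;> ring

/-- **First variation of the pointwise SSD integrand.**
With `P = det ∇(φ_m ∘ φ_o)(x) − f_o` and `Q = ∇×(φ_m ∘ φ_o)(x) − g_o`, the map
`t ↦ ½(det ∇((φ_m + t•v) ∘ φ_o)(x) − f_o)² + ½‖∇×((φ_m + t•v) ∘ φ_o)(x) − g_o‖²`
is differentiable at `t = 0` with derivative
`P · trace(adjugate(∇φ_m(φ_o x)) · ∇v(φ_o x)) · det ∇φ_o(x) + Q · ∇×(v ∘ φ_o)(x)`. -/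
theorem ssd_integrand_hasDerivAt
    (φo φm v : E3 → E3) (x : E3) (fo : ℝ) (go : E3)
    (ho : DifferentiableAt ℝ φo x)
    (hm : DifferentiableAt ℝ φm (φo x))
    (hv : DifferentiableAt ℝ v (φo x)) :
    HasDerivAt
      (fun t : ℝ =>
        (1 / 2) * ((jacobianMatrix ((fun y => φm y + t • v y) ∘ φo) x).det - fo) ^ 2
          + (1 / 2) * ‖curlE ((fun y => φm y + t • v y) ∘ φo) x - go‖ ^ 2)
      (((jacobianMatrix (φm ∘ φo) x).det - fo)
          * ((jacobianMatrix φm (φo x)).adjugate * jacobianMatrix v (φo x)).trace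
          * (jacobianMatrix φo x).det
        + ⟪curlE (φm ∘ φo) x - go, curlE (v ∘ φo) x⟫) 0 := by
  have hdet : HasDerivAt
      (fun t : ℝ => (jacobianMatrix ((fun y => φm y + t • v y) ∘ φo) x).det)
      (((jacobianMatrix φm (φo x)).adjugate * jacobianMatrix v (φo x)).trace
        * (jacobianMatrix φo x).det) 0 := by
    have h (t : ℝ) : (jacobianMatrix ((fun y => φm y + t • v y) ∘ φo) x).det =
        (jacobianMatrix φm (φo x) + t • jacobianMatrix v (φo x)).det
          * (jacobianMatrix φo x).det := by
      rw [jacobianMatrix_comp (hm.fun_add (hv.fun_const_smul t)) ho, jacobianMatrix_add_smul hm hv,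
        Matrix.det_mul]
    simp only [h]
    exact (Matrix.hasDerivAt_det_add_smul_fin_three _ _).mul_const _
  have hcurl : HasDerivAt
      (fun t : ℝ => curlE ((fun y => φm y + t • v y) ∘ φo) x - go) (curlE (v ∘ φo) x) 0 := by
    have h (t : ℝ) : curlE ((fun y => φm y + t • v y) ∘ φo) x =
        curlE (φm ∘ φo) x + t • curlE (v ∘ φo) x :=
      curlE_add_smul (hm.comp x ho) (hv.comp x ho) t
    simp only [h]
    simpa using (((hasDerivAt_id (0 : ℝ)).smul_const (curlE (v ∘ φo) x)).const_add
      (curlE (φm ∘ φo) x)).sub_const go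
  have h := (((hdet.sub_const fo).pow 2).const_mul (1 / 2 : ℝ)).add
    (hcurl.norm_sq.const_mul (1 / 2 : ℝ))
  simp only [zero_smul, add_zero] at h
  refine h.congr_deriv ?_
  ring
end
end

section
/- Let A₁, A₂, A₃ : ℝ³ → ℝ³ be continuously differentiable vector fields, and let B : ℝ³ → ℝ³ be twice continuously differentiable with ΔBᵢ = −∇·Aᵢ on ℝ³ for i = 1, 2, 3. Then for every twice continuously differentiable v : ℝ³ → ℝ³ with compact support, ∫_{ℝ³} Σᵢ Aᵢ(x)·∇vᵢ(x) dx = ∫_{ℝ³} B(x)·(Δv)(x) dx. (This identifies B as the variational gradient ∂SSD/∂F of the SSD functional with respect to the control function F = Δu.) -/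
noncomputable section

open MeasureTheory RealInnerProductSpace

/-- Gradient of a scalar function on ℝ³. -/
def gradE (f : E3 → ℝ) (x : E3) : E3 :=
  (WithLp.equiv 2 (Fin 3 → ℝ)).symm fun i => pd i f x

/-- Divergence of a vector field on ℝ³. -/
def divE (F : E3 → E3) (x : E3) : ℝ :=
  ∑ i, pd i (fun y => F y i) x

/-- Laplacian of a scalar function on ℝ³. -/
def lapS (f : E3 → ℝ) (x : E3) : ℝ :=
  ∑ i, pd i (pd i f) x

/-- Componentwise (vector) Laplacian of a vector field on ℝ³. -/
def lapV (F : E3 → E3) (x : E3) : E3 :=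
  (WithLp.equiv 2 (Fin 3 → ℝ)).symm fun i => lapS (fun y => F y i) x

lemma ContDiff.pd {n : WithTop ℕ∞} {f : E3 → ℝ} (hf : ContDiff ℝ (n + 1) f) (i : Fin 3) :
    ContDiff ℝ n (pd i f) :=
  (hf.fderiv_right le_rfl).clm_apply contDiff_const

lemma ContDiff.continuous_pd {f : E3 → ℝ} (hf : ContDiff ℝ 1 f) (i : Fin 3) :
    Continuous (_root_.pd i f) :=
  (hf.continuous_fderiv one_ne_zero).clm_apply continuous_const

lemma HasCompactSupport.pd {f : E3 → ℝ} (hf : HasCompactSupport f) (i : Fin 3) :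
    HasCompactSupport (pd i f) :=
  hf.fderiv_apply ℝ _

lemma integrable_mul_pd {f g : E3 → ℝ} (hf : Continuous f) (hg : ContDiff ℝ 1 g)
    (hgc : HasCompactSupport g) (i : Fin 3) : Integrable (fun x => f x * pd i g x) :=
  (hf.mul (hg.continuous_pd i)).integrable_of_hasCompactSupport (hgc.pd i).mul_left

lemma integrable_pd_mul {f g : E3 → ℝ} (hf : ContDiff ℝ 1 f) (hg : Continuous g)
    (hgc : HasCompactSupport g) (i : Fin 3) : Integrable (fun x => pd i f x * g x) :=
  ((hf.continuous_pd i).mul hg).integrable_of_hasCompactSupport hgc.mul_left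

/-- Integration by parts for a partial derivative. -/
lemma integral_mul_pd {f g : E3 → ℝ} (hf : ContDiff ℝ 1 f) (hg : ContDiff ℝ 1 g)
    (hgc : HasCompactSupport g) (i : Fin 3) :
    ∫ x, f x * pd i g x = -∫ x, pd i f x * g x :=
  integral_mul_fderiv_eq_neg_fderiv_mul_of_integrable
    (integrable_pd_mul hf hg.continuous hgc i) (integrable_mul_pd hf.continuous hg hgc i)
    ((hf.continuous.mul hg.continuous).integrable_of_hasCompactSupport hgc.mul_left)
    (fun x _ => hf.differentiable one_ne_zero x) (fun x _ => hg.differentiable one_ne_zero x)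

lemma inner_eq_sum_mul (x y : E3) : ⟪x, y⟫ = ∑ j, x j * y j := by
  simp [PiLp.inner_apply, mul_comm]

/-- The divergence is minus the adjoint of the gradient. -/
lemma integral_inner_gradE {F : E3 → E3} {g : E3 → ℝ} (hF : ContDiff ℝ 1 F)
    (hg : ContDiff ℝ 1 g) (hgc : HasCompactSupport g) :
    ∫ x, ⟪F x, gradE g x⟫ = -∫ x, divE F x * g x := by
  have hFj (j : Fin 3) : ContDiff ℝ 1 fun x => F x j := contDiff_euclidean.1 hF j
  simp only [inner_eq_sum_mul, gradE, divE, WithLp.equiv_symm_apply, Finset.sum_mul]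
  rw [integral_finsetSum _ fun j _ => integrable_mul_pd (hFj j).continuous hg hgc j,
    integral_finsetSum _ fun j _ => integrable_pd_mul (hFj j) hg.continuous hgc j,
    ← Finset.sum_neg_distrib]
  exact Finset.sum_congr rfl fun j _ => integral_mul_pd (hFj j) hg hgc j

/-- Green's second identity for a compactly supported function. -/
lemma integral_mul_lapS {f g : E3 → ℝ} (hf : ContDiff ℝ 2 f) (hg : ContDiff ℝ 2 g)
    (hgc : HasCompactSupport g) :
    ∫ x, f x * lapS g x = ∫ x, lapS f x * g x := by
  have hf1 : ContDiff ℝ 1 f := hf.of_le one_le_two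
  have hg1 : ContDiff ℝ 1 g := hg.of_le one_le_two
  have hfj (j : Fin 3) : ContDiff ℝ 1 (pd j f) := ContDiff.pd (by simpa [one_add_one_eq_two]) j
  have hgj (j : Fin 3) : ContDiff ℝ 1 (pd j g) := ContDiff.pd (by simpa [one_add_one_eq_two]) j
  simp only [lapS, Finset.mul_sum, Finset.sum_mul]
  rw [integral_finsetSum _ fun j _ => integrable_mul_pd hf.continuous (hgj j) (hgc.pd j) j,
    integral_finsetSum _ fun j _ => integrable_pd_mul (hfj j) hg.continuous hgc j]
  refine Finset.sum_congr rfl fun j _ => ?_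
  rw [integral_mul_pd hf1 (hgj j) (hgc.pd j), integral_mul_pd (hfj j) hg1 hgc, neg_neg]

/-- **`B` is the variational gradient `∂SSD/∂F`.** If `A₁, A₂, A₃` are `C¹` vector
fields and `B` is a `C²` vector field with `ΔBᵢ = −∇·Aᵢ` for `i = 1, 2, 3`, then for
every `C²` compactly supported vector field `v`,
`∫ Σᵢ Aᵢ·∇vᵢ = ∫ B·(Δv)`. -/
theorem variational_gradient_identity
    (A : Fin 3 → E3 → E3) (B : E3 → E3)
    (hA : ∀ i, ContDiff ℝ 1 (A i)) (hB : ContDiff ℝ 2 B)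
    (hBA : ∀ i : Fin 3, ∀ x : E3, lapS (fun y => B y i) x = -divE (A i) x)
    (v : E3 → E3) (hv : ContDiff ℝ 2 v) (hvsupp : HasCompactSupport v) :
    ∫ x : E3, ∑ i, ⟪A i x, gradE (fun y => v y i) x⟫
      = ∫ x : E3, ⟪B x, lapV v x⟫ := by
  have hvi (i : Fin 3) : ContDiff ℝ 2 fun x => v x i := contDiff_euclidean.1 hv i
  have hvi1 (i : Fin 3) : ContDiff ℝ 1 fun x => v x i := (hvi i).of_le one_le_two
  have hvc (i : Fin 3) : HasCompactSupport fun x => v x i :=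
    hvsupp.comp_left (g := fun y : E3 => y i) rfl
  have hBi (i : Fin 3) : ContDiff ℝ 2 fun x => B x i := contDiff_euclidean.1 hB i
  have hint_grad (i : Fin 3) : Integrable fun x => ⟪A i x, gradE (fun y => v y i) x⟫ := by
    simp only [inner_eq_sum_mul, gradE, WithLp.equiv_symm_apply]
    exact integrable_finsetSum _ fun j _ =>
      integrable_mul_pd (contDiff_euclidean.1 (hA i) j).continuous (hvi1 i) (hvc i) j
  have hint_lap (i : Fin 3) : Integrable fun x => B x i * lapS (fun y => v y i) x := by
    simp only [lapS, Finset.mul_sum]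
    exact integrable_finsetSum _ fun j _ =>
      integrable_mul_pd (hBi i).continuous
        (ContDiff.pd (by simpa [one_add_one_eq_two] using hvi i) j) ((hvc i).pd j) j
  simp only [inner_eq_sum_mul (B _), lapV, WithLp.equiv_symm_apply]
  rw [integral_finsetSum _ fun i _ => hint_grad i, integral_finsetSum _ fun i _ => hint_lap i]
  refine Finset.sum_congr rfl fun i _ => ?_
  rw [integral_inner_gradE (hA i) (hvi1 i) (hvc i), integral_mul_lapS (hBi i) (hvi i) (hvc i)]
  simp only [hBA, neg_mul, integral_neg]
end
end
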